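/- Let Ŝ be a groupwise calibrated soft classifier and g₁, g₂ two groups whose accuracy profiles are equal: 𝒫_{g₁} = 𝒫_{g₂}. Let D̂ be any group-blind hard post-processor such that Ŷ = D̂∘Ŝ is non-trivial on both groups and 0 < BR_{g_i} < 1 for i = 1, 2. Then PPV, NPV, FPR, and FNR are each equal across the two groups: PPV_{Ŷ,g₁} = PPV_{Ŷ,g₂}, NPV_{Ŷ,g₁} = NPV_{Ŷ,g₂}, FPR_{Ŷ,g₁} = FPR_{Ŷ,g₂}, and FNR_{Ŷ,g₁} = FNR_{Ŷ,g₂}. -/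

import Mathlib

open Finset
open scoped Classical

namespace GroupFairness

noncomputable section

variable {X 𝒢 Ω : Type*} [Fintype X] [Fintype Ω]

/-- The finset of members of group `g`. -/
def grp (Grp : X → 𝒢) (g : 𝒢) : Finset X :=
  Finset.univ.filter (fun x => Grp x = g)

/-- Expectation of `f x ω` over a uniformly random member `x` of group `g`,
together with internal randomness `ω` distributed according to the weights `w`. -/
def Ex (w : Ω → ℝ) (Grp : X → 𝒢) (g : 𝒢) (f : X → Ω → ℝ) : ℝ :=
  (∑ x ∈ grp Grp g, ∑ ω : Ω, w ω * f x ω) / ((grp Grp g).card : ℝ)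

/-- Probability of the event `E x ω` for a uniformly random member of group `g`. -/
def Pr (w : Ω → ℝ) (Grp : X → 𝒢) (g : 𝒢) (E : X → Ω → Prop) : ℝ :=
  Ex w Grp g (fun x ω => if E x ω then 1 else 0)

/-- Conditional probability of `E` given `F`. -/
def cPr (w : Ω → ℝ) (Grp : X → 𝒢) (g : 𝒢) (E F : X → Ω → Prop) : ℝ :=
  Pr w Grp g (fun x ω => E x ω ∧ F x ω) / Pr w Grp g F

/-- `w` is a probability weighting on the randomness space. -/
def ValidWeights (w : Ω → ℝ) : Prop :=
  (∀ ω, 0 ≤ w ω) ∧ ∑ ω : Ω, w ω = 1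

/-- The base rate of group `g`: the probability that a uniformly random member
of `g` has true type `1`. -/
def BaseRate (w : Ω → ℝ) (Grp : X → 𝒢) (Y : X → Bool) (g : 𝒢) : ℝ :=
  Pr w Grp g (fun x _ => Y x = true)

/-- All scores of the soft classifier lie in `[0,1]`. -/
def IsSoft (S : X → Ω → ℝ) : Prop :=
  ∀ x ω, 0 ≤ S x ω ∧ S x ω ≤ 1

/-- `S` is groupwise calibrated: for every group `g` and score `s` occurring with
positive probability, `Pr[Y = 1 ∣ S = s] = s`. -/
def Calibrated (w : Ω → ℝ) (Grp : X → 𝒢) (Y : X → Bool) (S : X → Ω → ℝ) : Prop :=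
  ∀ (g : 𝒢) (s : ℝ), 0 < Pr w Grp g (fun x ω => S x ω = s) →
    cPr w Grp g (fun x _ => Y x = true) (fun x ω => S x ω = s) = s

/-- The accuracy profile of `S` on group `g`: the pmf of the score `S(X_g)`. -/
def AP (w : Ω → ℝ) (Grp : X → 𝒢) (S : X → Ω → ℝ) (g : 𝒢) (s : ℝ) : ℝ :=
  Pr w Grp g (fun x ω => S x ω = s)

/-- The support of the accuracy profile of `S` on group `g`. -/
def APsupp (w : Ω → ℝ) (Grp : X → 𝒢) (S : X → Ω → ℝ) (g : 𝒢) : Set ℝ :=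
  {s | 0 < AP w Grp S g s}

/-- The accuracy profile is *nice*: all groups have the same support. -/
def NiceAP (w : Ω → ℝ) (Grp : X → 𝒢) (S : X → Ω → ℝ) : Prop :=
  ∀ g g' : 𝒢, APsupp w Grp S g = APsupp w Grp S g'

/-- A (randomized) hard post-processor is described by the probability `q s g` of
outputting `1` on score `s` and group `g`; it is valid if these are probabilities. -/
def ValidPP (q : ℝ → 𝒢 → ℝ) : Prop :=
  ∀ (s : ℝ) (g : 𝒢), 0 ≤ q s g ∧ q s g ≤ 1

/-- Probability that the composed hard classifier `D̂ ∘ Ŝ` outputs `1` on group `g`. -/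
def prPos (w : Ω → ℝ) (Grp : X → 𝒢) (S : X → Ω → ℝ) (q : ℝ → 𝒢 → ℝ) (g : 𝒢) : ℝ :=
  Ex w Grp g (fun x ω => q (S x ω) (Grp x))

/-- Probability that the composed hard classifier `D̂ ∘ Ŝ` outputs `0` on group `g`. -/
def prNeg (w : Ω → ℝ) (Grp : X → 𝒢) (S : X → Ω → ℝ) (q : ℝ → 𝒢 → ℝ) (g : 𝒢) : ℝ :=
  Ex w Grp g (fun x ω => 1 - q (S x ω) (Grp x))

/-- The composed hard classifier is non-trivial on `g`. -/
def NonTrivial (w : Ω → ℝ) (Grp : X → 𝒢) (S : X → Ω → ℝ) (q : ℝ → 𝒢 → ℝ) (g : 𝒢) : Prop :=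
  0 < prPos w Grp S q g ∧ 0 < prNeg w Grp S q g

/-- Positive predictive value `Pr[Y = 1 ∣ Ŷ = 1]` of the composed classifier on `g`. -/
def PPV (w : Ω → ℝ) (Grp : X → 𝒢) (Y : X → Bool) (S : X → Ω → ℝ)
    (q : ℝ → 𝒢 → ℝ) (g : 𝒢) : ℝ :=
  Ex w Grp g (fun x ω => (if Y x then 1 else 0) * q (S x ω) (Grp x)) / prPos w Grp S q g

/-- Negative predictive value `Pr[Y = 0 ∣ Ŷ = 0]` of the composed classifier on `g`. -/
def NPV (w : Ω → ℝ) (Grp : X → 𝒢) (Y : X → Bool) (S : X → Ω → ℝ)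
    (q : ℝ → 𝒢 → ℝ) (g : 𝒢) : ℝ :=
  Ex w Grp g (fun x ω => (if Y x then 0 else 1) * (1 - q (S x ω) (Grp x))) / prNeg w Grp S q g

/-- False positive rate `Pr[Ŷ = 1 ∣ Y = 0]` of the composed classifier on `g`. -/
def FPR (w : Ω → ℝ) (Grp : X → 𝒢) (Y : X → Bool) (S : X → Ω → ℝ)
    (q : ℝ → 𝒢 → ℝ) (g : 𝒢) : ℝ :=
  Ex w Grp g (fun x ω => (if Y x then 0 else 1) * q (S x ω) (Grp x)) /
    Pr w Grp g (fun x _ => Y x = false)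

/-- False negative rate `Pr[Ŷ = 0 ∣ Y = 1]` of the composed classifier on `g`. -/
def FNR (w : Ω → ℝ) (Grp : X → 𝒢) (Y : X → Bool) (S : X → Ω → ℝ)
    (q : ℝ → 𝒢 → ℝ) (g : 𝒢) : ℝ :=
  Ex w Grp g (fun x ω => (if Y x then 1 else 0) * (1 - q (S x ω) (Grp x))) /
    Pr w Grp g (fun x _ => Y x = true)

/-- The threshold post-processor with threshold `τ g` and on-threshold probability
`R g` for group `g`: it outputs `1` with probability `1` above the threshold, `0`
below it, and `1` with probability `R g` at the threshold. -/
def thresholdPP (τ R : 𝒢 → ℝ) : ℝ → 𝒢 → ℝ := fun s g =>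
  if τ g < s then 1 else if s = τ g then R g else 0

/-- An expectation involving a function of the score splits as a sum over the values of the score. -/
theorem Ex_mul_comp_score (w : Ω → ℝ) (Grp : X → 𝒢) (S : X → Ω → ℝ) (g : 𝒢)
    (c : X → ℝ) (h : ℝ → ℝ) :
    Ex w Grp g (fun x ω => c x * h (S x ω)) =
      ∑ s ∈ Finset.univ.image (fun p : X × Ω => S p.1 p.2),
        h s * Ex w Grp g (fun x ω => c x * if S x ω = s then 1 else 0) := by
  symm
  unfold Ex
  simp_rw [mul_div_assoc', ← Finset.sum_div, Finset.mul_sum]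
  rw [Finset.sum_comm]
  congr 1
  refine Finset.sum_congr rfl fun x _ => ?_
  rw [Finset.sum_comm]
  refine Finset.sum_congr rfl fun ω _ => ?_
  rw [Finset.sum_eq_single (S x ω)]
  · simp
    ring
  · intro s _ hs
    simp [hs.symm]
  · intro hs
    exact absurd (Finset.mem_image_of_mem (fun p : X × Ω => S p.1 p.2)
      (Finset.mem_univ (x, ω))) hs

theorem Ex_mono {w : Ω → ℝ} (hw : ∀ ω, 0 ≤ w ω) (Grp : X → 𝒢) (g : 𝒢) {f f' : X → Ω → ℝ}
    (hf : ∀ x ω, f x ω ≤ f' x ω) : Ex w Grp g f ≤ Ex w Grp g f' := by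
  unfold Ex
  gcongr with x _ ω _
  · exact hw ω
  · exact hf x ω

theorem Ex_sub (w : Ω → ℝ) (Grp : X → 𝒢) (g : 𝒢) (f f' : X → Ω → ℝ) :
    Ex w Grp g (fun x ω => f x ω - f' x ω) = Ex w Grp g f - Ex w Grp g f' := by
  simp only [Ex, mul_sub, Finset.sum_sub_distrib, sub_div]

theorem Ex_zero (w : Ω → ℝ) (Grp : X → 𝒢) (g : 𝒢) : Ex w Grp g (fun _ _ => 0) = 0 := by
  simp [Ex]

/-- Calibration in product form, valid also at scores of probability zero. -/
theorem Calibrated.Ex_indicator {w : Ω → ℝ} {Grp : X → 𝒢} {Y : X → Bool} {S : X → Ω → ℝ}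
    (hcal : Calibrated w Grp Y S) (hw : ∀ ω, 0 ≤ w ω) (g : 𝒢) (s : ℝ) :
    Ex w Grp g (fun x ω => (if Y x then 1 else 0) * if S x ω = s then 1 else 0) =
      s * AP w Grp S g s := by
  have hnonneg : 0 ≤ Ex w Grp g
      (fun x ω => (if Y x then 1 else 0) * if S x ω = s then 1 else 0) := by
    refine (Ex_zero w Grp g).symm.trans_le (Ex_mono hw Grp g fun x ω => ?_)
    split_ifs <;> norm_num
  have hle : Ex w Grp g (fun x ω => (if Y x then 1 else 0) * if S x ω = s then 1 else 0) ≤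
      AP w Grp S g s := by
    refine Ex_mono hw Grp g fun x ω => ?_
    split_ifs <;> norm_num
  rcases (hnonneg.trans hle).eq_or_lt with h0 | hpos
  · rw [← h0] at hle ⊢
    linarith
  · have h := hcal g s hpos
    change _ / AP w Grp S g s = s at h
    rw [div_eq_iff hpos.ne'] at h
    rw [← h, Pr]
    congr 1
    ext x ω
    by_cases hY : Y x = true <;> simp [hY]

section EqualProfiles

variable {w : Ω → ℝ} {Grp : X → 𝒢} {Y : X → Bool} {S : X → Ω → ℝ} {g₁ g₂ : 𝒢}

theorem Ex_comp_score_eq_of_AP_eq (hAP : ∀ s, AP w Grp S g₁ s = AP w Grp S g₂ s) (h : ℝ → ℝ) :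
    Ex w Grp g₁ (fun x ω => h (S x ω)) = Ex w Grp g₂ (fun x ω => h (S x ω)) := by
  have key (g : 𝒢) := Ex_mul_comp_score w Grp S g (fun _ => 1) h
  simp only [one_mul] at key
  rw [key, key]
  exact Finset.sum_congr rfl fun s _ => congrArg (h s * ·) (hAP s)

theorem Calibrated.Ex_pos_mul_comp_score_eq (hcal : Calibrated w Grp Y S) (hw : ∀ ω, 0 ≤ w ω)
    (hAP : ∀ s, AP w Grp S g₁ s = AP w Grp S g₂ s) (h : ℝ → ℝ) :
    Ex w Grp g₁ (fun x ω => (if Y x then 1 else 0) * h (S x ω)) =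
      Ex w Grp g₂ (fun x ω => (if Y x then 1 else 0) * h (S x ω)) := by
  rw [Ex_mul_comp_score, Ex_mul_comp_score]
  simp only [hcal.Ex_indicator hw, hAP]

theorem Calibrated.Ex_neg_mul_comp_score_eq (hcal : Calibrated w Grp Y S) (hw : ∀ ω, 0 ≤ w ω)
    (hAP : ∀ s, AP w Grp S g₁ s = AP w Grp S g₂ s) (h : ℝ → ℝ) :
    Ex w Grp g₁ (fun x ω => (if Y x then 0 else 1) * h (S x ω)) =
      Ex w Grp g₂ (fun x ω => (if Y x then 0 else 1) * h (S x ω)) := by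
  have hsplit (x : X) (ω : Ω) : (if Y x then 0 else 1) * h (S x ω) =
      h (S x ω) - (if Y x then 1 else 0) * h (S x ω) := by
    split_ifs <;> ring
  simp only [hsplit, Ex_sub]
  rw [Ex_comp_score_eq_of_AP_eq hAP, hcal.Ex_pos_mul_comp_score_eq hw hAP]

end EqualProfiles

/-- If a groupwise calibrated soft classifier has equal accuracy
profiles on two groups, then any group-blind hard post-processor (composing to a
classifier non-trivial on both groups, with both base rates strictly between 0 and 1)
equalizes PPV, NPV, FPR and FNR across the two groups. -/
theorem equal_APs_groupBlind_equalizes_all_four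
    (w : Ω → ℝ) (Grp : X → 𝒢) (Y : X → Bool) (S : X → Ω → ℝ)
    (q : ℝ → 𝒢 → ℝ) (g₁ g₂ : 𝒢)
    (hw : ValidWeights w) (hne : ∀ g : 𝒢, (grp Grp g).Nonempty)
    (hS : IsSoft S) (hcal : Calibrated w Grp Y S) (hq : ValidPP q)
    (hblind : ∀ (s : ℝ) (g g' : 𝒢), q s g = q s g')
    (hAP : ∀ s : ℝ, AP w Grp S g₁ s = AP w Grp S g₂ s)
    (hnt₁ : NonTrivial w Grp S q g₁) (hnt₂ : NonTrivial w Grp S q g₂)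
    (hBR₁ : 0 < BaseRate w Grp Y g₁ ∧ BaseRate w Grp Y g₁ < 1)
    (hBR₂ : 0 < BaseRate w Grp Y g₂ ∧ BaseRate w Grp Y g₂ < 1) :
    PPV w Grp Y S q g₁ = PPV w Grp Y S q g₂ ∧
      NPV w Grp Y S q g₁ = NPV w Grp Y S q g₂ ∧
      FPR w Grp Y S q g₁ = FPR w Grp Y S q g₂ ∧
      FNR w Grp Y S q g₁ = FNR w Grp Y S q g₂ := by
  have hq_eq (x : X) (ω : Ω) : q (S x ω) (Grp x) = q (S x ω) g₁ := hblind _ _ _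
  have hpos := hcal.Ex_pos_mul_comp_score_eq hw.1 hAP
  have hneg := hcal.Ex_neg_mul_comp_score_eq hw.1 hAP
  have hY : Pr w Grp g₁ (fun x _ => Y x = true) = Pr w Grp g₂ (fun x _ => Y x = true) := by
    have hind (g : 𝒢) : Pr w Grp g (fun x _ => Y x = true) =
        Ex w Grp g (fun x _ => (if Y x then 1 else 0) * 1) := by
      unfold Pr
      congr 1
      ext x ω
      by_cases hYx : Y x = true <;> simp [hYx]
    rw [hind, hind]
    exact hpos fun _ => 1
  have hY' : Pr w Grp g₁ (fun x _ => Y x = false) = Pr w Grp g₂ (fun x _ => Y x = false) := by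
    have hind (g : 𝒢) : Pr w Grp g (fun x _ => Y x = false) =
        Ex w Grp g (fun x _ => (if Y x then 0 else 1) * 1) := by
      unfold Pr
      congr 1
      ext x ω
      by_cases hYx : Y x = true <;> simp [hYx]
    rw [hind, hind]
    exact hneg fun _ => 1
  simp only [PPV, NPV, FPR, FNR, prPos, prNeg, hq_eq, hY, hY']
  rw [Ex_comp_score_eq_of_AP_eq hAP (q · g₁), Ex_comp_score_eq_of_AP_eq hAP (1 - q · g₁),
    hpos (q · g₁), hpos (1 - q · g₁), hneg (q · g₁), hneg (1 - q · g₁)]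
  exact ⟨rfl, rfl, rfl, rfl⟩

end

end GroupFairness
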